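/- Let V be a MOSVA and W a V-bimodule, both satisfying the pole-order condition. Let u_1,…,u_n ∈ V, 0 ≤ l ≤ n, and w ∈ W with Y_W^L(u,x)w ∈ W[[x]] and Y_W^{s(R)}(u,x)w ∈ W[[x]] for all u ∈ V. Let m be a positive integer and v_1,…,v_m ∈ V. Then for each p = 0,…,m, the series Y_W^L(v_1,z_1)⋯Y_W^L(v_p,z_p)Y_W^{s(R)}(v_{p+1},z_{p+1})⋯Y_W^{s(R)}(v_m,z_m)·E(Y_W^L(u_1,z_{m+1})⋯Y_W^L(u_l,z_{m+l})Y_W^{s(R)}(u_{l+1},z_{m+l+1})⋯Y_W^{s(R)}(u_n,z_{m+n})w) converges absolutely when |z_1|>⋯>|z_m|>|z_i| for i = m+1,…,m+n, to the \overline{W}-valued rational function E(Y_W^L(v_1,z_1)⋯Y_W^L(v_p,z_p)Y_W^{s(R)}(v_{p+1},z_{p+1})⋯Y_W^{s(R)}(v_m,z_m)Y_W^L(u_1,z_{m+1})⋯Y_W^L(u_l,z_{m+l})Y_W^{s(R)}(u_{l+1},z_{m+l+1})⋯Y_W^{s(R)}(u_n,z_{m+n})w). -/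

import Mathlib

set_option autoImplicit false
set_option maxHeartbeats 1000000

open scoped BigOperators

noncomputable section

namespace VA

/-- Absolute convergence of a series of complex numbers indexed by `ι` to the sum `s`. -/
def AbsConvTo {ι : Type*} (f : ι → ℂ) (s : ℂ) : Prop :=
  Summable (fun i => ‖f i‖) ∧ HasSum f s

/-- The configuration-space condition: the entries of `z` are pairwise distinct. -/
def Conf {ι : Type*} (z : ι → ℂ) : Prop := ∀ i j : ι, i ≠ j → z i ≠ z j

/-- `‖z 0‖ > ‖z 1‖ > ⋯ > ‖z (n-1)‖`. -/
def Ordered {n : ℕ} (z : Fin n → ℂ) : Prop := ∀ i j : Fin n, i < j → ‖z j‖ < ‖z i‖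

/-- `‖z 0‖ > ‖z 1‖ > ⋯ > ‖z (n-1)‖ > 0`. -/
def OrderedPos {n : ℕ} (z : Fin n → ℂ) : Prop := Ordered z ∧ ∀ i, 0 < ‖z i‖

/-- A rational function in the variables `z i`, `i : ι`, whose only possible poles are
at `z i = 0` and on the diagonals `z i = z j` (`i ≠ j`); it is recorded as a numerator
polynomial together with the orders of the poles. -/
structure RatFn (ι : Type*) [Fintype ι] [DecidableEq ι] where
  num : MvPolynomial ι ℂ
  a : ι → ℕ
  b : ι → ι → ℕ

def RatFn.eval {ι : Type*} [Fintype ι] [DecidableEq ι] (R : RatFn ι) (z : ι → ℂ) : ℂ :=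
  MvPolynomial.eval z R.num /
    ((∏ i, z i ^ R.a i) * ∏ q ∈ Finset.univ.offDiag, (z q.1 - z q.2) ^ R.b q.1 q.2)

/-- A rational function in the variables `z i`, `i : ι`, whose only possible poles are
on the diagonals `z i = z j` (`i ≠ j`). -/
structure DiagRatFn (ι : Type*) [Fintype ι] [DecidableEq ι] where
  num : MvPolynomial ι ℂ
  b : ι → ι → ℕ

def DiagRatFn.eval {ι : Type*} [Fintype ι] [DecidableEq ι] (R : DiagRatFn ι) (z : ι → ℂ) : ℂ :=
  MvPolynomial.eval z R.num / ∏ q ∈ Finset.univ.offDiag, (z q.1 - z q.2) ^ R.b q.1 q.2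

/-- A linear functional belongs to the graded dual iff its restriction to all but
finitely many homogeneous components vanishes. -/
def InGradedDual {ι : Type*} {M : Type*} [AddCommGroup M] [Module ℂ M]
    (proj : ι → M →ₗ[ℂ] M) (φ : M →ₗ[ℂ] ℂ) : Prop :=
  (Function.support fun i => φ ∘ₗ proj i).Finite

/-- Iterated application: `compApply n f w = f 0 (f 1 (⋯ (f (n-1) w)))`. -/
def compApply {M : Type*} : (n : ℕ) → (Fin n → (M → M)) → M → M
  | 0, _, w => w
  | n+1, f, w => f 0 (compApply n (fun i => f i.succ) w)

section Graded

variable (W : Type*) [AddCommGroup W] [Module ℂ W]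

/-- A `ℂ`-grading of `W`, recorded via the projections onto the homogeneous
subspaces, whose weights have lower-bounded real parts. -/
structure CGrading where
  proj : ℂ → W →ₗ[ℂ] W
  proj_comp : ∀ m n : ℂ, proj m ∘ₗ proj n = if m = n then proj n else 0
  proj_finite : ∀ w : W, (Function.support fun n => proj n w).Finite
  proj_sum : ∀ w : W, (∑ᶠ n : ℂ, proj n w) = w
  lower_bound : ∃ B : ℝ, ∀ n : ℂ, n.re < B → proj n = 0

/-- A `ℤ`-grading of `V` with lower-bounded weights. -/
structure ZGrading where
  proj : ℤ → W →ₗ[ℂ] W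
  proj_comp : ∀ m n : ℤ, proj m ∘ₗ proj n = if m = n then proj n else 0
  proj_finite : ∀ w : W, (Function.support fun n => proj n w).Finite
  proj_sum : ∀ w : W, (∑ᶠ n : ℤ, proj n w) = w
  lower_bound : ∃ B : ℤ, ∀ n : ℤ, n < B → proj n = 0

variable {W}

/-- The grading operator `d` of a `ℂ`-graded space. -/
def CGrading.d (G : CGrading W) (w : W) : W := ∑ᶠ n : ℂ, n • G.proj n w

/-- The grading operator `d` of a `ℤ`-graded space. -/
def ZGrading.d (G : ZGrading W) (v : W) : W := ∑ᶠ n : ℤ, (n : ℂ) • G.proj n v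

/-- The operator `z^d` on a `ℤ`-graded space. -/
def ZGrading.zd (G : ZGrading W) (z : ℂ) (v : W) : W := ∑ᶠ n : ℤ, (z ^ n) • G.proj n v

/-- The algebraic completion `∏ₙ W_[n]`, realized as the submodule of functions
`ℂ → W` recording a homogeneous component in each weight. -/
def CGrading.compSub (G : CGrading W) : Submodule ℂ (ℂ → W) where
  carrier := {f | ∀ n, G.proj n (f n) = f n}
  add_mem' := by
    intro a b ha hb n
    simp only [Pi.add_apply, map_add, ha n, hb n]
  zero_mem' := by
    intro n
    simp
  smul_mem' := by
    intro c f hf n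
    simp only [Pi.smul_apply, map_smul, hf n]

/-- The algebraic completion of a graded space. -/
abbrev CGrading.Comp (G : CGrading W) : Type _ := ↥G.compSub

/-- The pairing between the graded dual and the algebraic completion. -/
def CGrading.pair (G : CGrading W) (φ : W →ₗ[ℂ] ℂ) (f : G.Comp) : ℂ :=
  ∑ᶠ n : ℂ, φ (f.1 n)

/-- The embedding of `W` into its algebraic completion. -/
def CGrading.emb (G : CGrading W) (w : W) : G.Comp :=
  ⟨fun n => G.proj n w, by
    intro n
    have h := congrArg (fun T : W →ₗ[ℂ] W => T w) (G.proj_comp n n)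
    simpa using h⟩

/-- The componentwise extension of an operator on `W` to the algebraic completion. -/
def CGrading.ext (G : CGrading W) (L : W → W) (f : G.Comp) : G.Comp :=
  ⟨fun m => ∑ᶠ n : ℂ, G.proj m (L (f.1 n)), by
    intro m
    show G.proj m (∑ᶠ n : ℂ, G.proj m (L (f.1 n))) = ∑ᶠ n : ℂ, G.proj m (L (f.1 n))
    by_cases h : (Function.support fun n => G.proj m (L (f.1 n))).Finite
    · have h1 := AddMonoidHom.map_finsum (G.proj m).toAddMonoidHom h
      simp only [LinearMap.toAddMonoidHom_coe] at h1
      rw [h1]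
      refine finsum_congr fun n => ?_
      have h2 := congrArg (fun T : W →ₗ[ℂ] W => T (L (f.1 n))) (G.proj_comp m m)
      simpa using h2
    · rw [finsum_of_infinite_support h]
      simp⟩

/-- The operator `z^d` on the algebraic completion, acting on the component of
weight `n` by `z ^ n` (complex power). -/
def CGrading.zd (G : CGrading W) (z : ℂ) (f : G.Comp) : G.Comp :=
  ⟨fun n => (z ^ n) • f.1 n, by
    intro n
    rw [map_smul, f.2 n]⟩

end Graded


section VOA

/-- A meromorphic open-string vertex algebra (MOSVA): a lower-bounded `ℤ`-graded
space with a vertex operator map (recorded through its coefficients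
`Y u v k = (Y_V)_k(u)v`, the coefficient of `x^{-k-1}` in `Y_V(u,x)v`) and a
vacuum, satisfying the grading, vacuum, `D`-derivative/commutator, rationality and
associativity axioms. -/
structure MOSVA (V : Type*) [AddCommGroup V] [Module ℂ V] where
  gr : ZGrading V
  Y : V →ₗ[ℂ] V →ₗ[ℂ] (ℤ → V)
  vac : V
  /-- lower truncation of vertex operators -/
  trunc : ∀ u v : V, ∃ N : ℤ, ∀ k : ℤ, N ≤ k → Y u v k = 0
  /-- identity property `Y(𝟏,x) = 1` -/
  identity : ∀ (v : V) (k : ℤ), Y vac v k = if k = -1 then v else 0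
  /-- creation property: `Y(u,x)𝟏 ∈ V[[x]]` and `lim_{x→0} Y(u,x)𝟏 = u` -/
  creation : ∀ (u : V) (k : ℤ), 0 ≤ k → Y u vac k = 0
  creation_lim : ∀ u : V, Y u vac (-1) = u
  /-- the `d`-commutator formula, written in terms of coefficients -/
  d_comm : ∀ (u v : V) (k : ℤ),
    gr.d (Y u v k) = Y (gr.d u) v k + (-(k : ℂ) - 1) • Y u v k + Y u (gr.d v) k
  /-- the `D`-derivative property (`D_V u = (Y_V)_{-2}(u)𝟏`) -/
  D_deriv : ∀ (u v : V) (k : ℤ),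
    Y (Y u vac (-2)) v k = (-(k : ℂ)) • Y u v (k - 1)
  /-- the `D`-commutator formula -/
  D_comm : ∀ (u v : V) (k : ℤ),
    Y (Y u v k) vac (-2) - Y u (Y v vac (-2)) k = (-(k : ℂ)) • Y u v (k - 1)
  /-- rationality of products: matrix coefficients of products of vertex operators
  converge absolutely in the ordered region to rational functions with the only
  possible poles at `z i = 0` and `z i = z j` -/
  rationality : ∀ (n : ℕ) (u : Fin n → V) (v : V) (φ : V →ₗ[ℂ] ℂ),
    InGradedDual gr.proj φ → ∃ R : RatFn (Fin n), ∀ z : Fin n → ℂ, OrderedPos z →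
      AbsConvTo (fun k : Fin n → ℤ =>
          φ (compApply n (fun i x => Y (u i) x (k i)) v) * ∏ i, z i ^ (-(k i) - 1))
        (R.eval z)
  /-- rationality of iterates and associativity: products and iterates converge to a
  common rational function -/
  associativity : ∀ (u₁ u₂ v : V) (φ : V →ₗ[ℂ] ℂ), InGradedDual gr.proj φ →
    ∃ R : RatFn (Fin 2),
      (∀ z₁ z₂ : ℂ, ‖z₂‖ < ‖z₁‖ → 0 < ‖z₂‖ →
        AbsConvTo (fun k : ℤ × ℤ =>
            φ (Y u₁ (Y u₂ v k.2) k.1) * z₁ ^ (-k.1 - 1) * z₂ ^ (-k.2 - 1))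
          (R.eval ![z₁, z₂])) ∧
      (∀ z₁ z₂ : ℂ, ‖z₁ - z₂‖ < ‖z₂‖ → 0 < ‖z₁ - z₂‖ →
        AbsConvTo (fun k : ℤ × ℤ =>
            φ (Y (Y u₁ u₂ k.1) v k.2) * (z₁ - z₂) ^ (-k.1 - 1) * z₂ ^ (-k.2 - 1))
          (R.eval ![z₁, z₂]))

variable {V : Type*} [AddCommGroup V] [Module ℂ V]

/-- The operator `D_V`. -/
def MOSVA.D (A : MOSVA V) (v : V) : V := A.Y v A.vac (-2)

/-- The pole-order condition for a MOSVA. -/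
def MOSVA.PoleOrder (A : MOSVA V) : Prop :=
  ∀ u₁ v : V, ∃ C : ℕ, ∀ φ : V →ₗ[ℂ] ℂ, InGradedDual A.gr.proj φ → ∀ u₂ : V,
    ∃ R : RatFn (Fin 2), R.a 0 ≤ C ∧
      ∀ z₁ z₂ : ℂ, ‖z₂‖ < ‖z₁‖ → 0 < ‖z₂‖ →
        AbsConvTo (fun k : ℤ × ℤ =>
            φ (A.Y u₁ (A.Y u₂ v k.2) k.1) * z₁ ^ (-k.1 - 1) * z₂ ^ (-k.2 - 1))
          (R.eval ![z₁, z₂])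

/-- A bimodule for a MOSVA: a `ℂ`-graded space with left and right vertex operator
maps (recorded through their coefficients), satisfying the left module, right module
and compatibility axioms. -/
structure Bimod (A : MOSVA V) (W : Type*) [AddCommGroup W] [Module ℂ W] where
  gr : CGrading W
  YL : V →ₗ[ℂ] W →ₗ[ℂ] (ℤ → W)
  YR : W →ₗ[ℂ] V →ₗ[ℂ] (ℤ → W)
  DW : W →ₗ[ℂ] W
  /-- `D_W` has weight one -/
  DW_wt : ∀ n : ℂ, DW ∘ₗ gr.proj n = gr.proj (n + 1) ∘ₗ DW ∘ₗ gr.proj n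
  truncL : ∀ (u : V) (w : W), ∃ N : ℤ, ∀ k : ℤ, N ≤ k → YL u w k = 0
  truncR : ∀ (w : W) (u : V), ∃ N : ℤ, ∀ k : ℤ, N ≤ k → YR w u k = 0
  identityL : ∀ (w : W) (k : ℤ), YL A.vac w k = if k = -1 then w else 0
  creationR : ∀ (w : W) (k : ℤ), 0 ≤ k → YR w A.vac k = 0
  creationR_lim : ∀ w : W, YR w A.vac (-1) = w
  d_commL : ∀ (u : V) (w : W) (k : ℤ),
    gr.d (YL u w k) = YL (A.gr.d u) w k + (-(k : ℂ) - 1) • YL u w k + YL u (gr.d w) k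
  d_commR : ∀ (w : W) (u : V) (k : ℤ),
    gr.d (YR w u k) = YR (gr.d w) u k + (-(k : ℂ) - 1) • YR w u k + YR w (A.gr.d u) k
  D_derivL : ∀ (u : V) (w : W) (k : ℤ),
    YL (A.D u) w k = (-(k : ℂ)) • YL u w (k - 1)
  D_commL : ∀ (u : V) (w : W) (k : ℤ),
    DW (YL u w k) - YL u (DW w) k = (-(k : ℂ)) • YL u w (k - 1)
  D_derivR : ∀ (w : W) (u : V) (k : ℤ),
    YR (DW w) u k = (-(k : ℂ)) • YR w u (k - 1)
  D_commR : ∀ (w : W) (u : V) (k : ℤ),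
    DW (YR w u k) - YR w (A.D u) k = (-(k : ℂ)) • YR w u (k - 1)
  /-- rationality for products of left vertex operators -/
  rationalityL : ∀ (n : ℕ) (u : Fin n → V) (w : W) (φ : W →ₗ[ℂ] ℂ),
    InGradedDual gr.proj φ → ∃ R : RatFn (Fin n), ∀ z : Fin n → ℂ, OrderedPos z →
      AbsConvTo (fun k : Fin n → ℤ =>
          φ (compApply n (fun i x => YL (u i) x (k i)) w) * ∏ i, z i ^ (-(k i) - 1))
        (R.eval z)
  /-- rationality of iterates and associativity for the left vertex operator map -/
  associativityL : ∀ (u₁ u₂ : V) (w : W) (φ : W →ₗ[ℂ] ℂ), InGradedDual gr.proj φ →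
    ∃ R : RatFn (Fin 2),
      (∀ z₁ z₂ : ℂ, ‖z₂‖ < ‖z₁‖ → 0 < ‖z₂‖ →
        AbsConvTo (fun k : ℤ × ℤ =>
            φ (YL u₁ (YL u₂ w k.2) k.1) * z₁ ^ (-k.1 - 1) * z₂ ^ (-k.2 - 1))
          (R.eval ![z₁, z₂])) ∧
      (∀ z₁ z₂ : ℂ, ‖z₁ - z₂‖ < ‖z₂‖ → 0 < ‖z₁ - z₂‖ →
        AbsConvTo (fun k : ℤ × ℤ =>
            φ (YL (A.Y u₁ u₂ k.1) w k.2) * (z₁ - z₂) ^ (-k.1 - 1) * z₂ ^ (-k.2 - 1))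
          (R.eval ![z₁, z₂]))
  /-- rationality for products `Y_W^R(w,z₁)Y_V(u₁,z₂)⋯Y_V(u_{n-1},z_n)u_n` -/
  rationalityR : ∀ (n : ℕ) (w : W) (v : Fin (n+1) → V) (φ : W →ₗ[ℂ] ℂ),
    InGradedDual gr.proj φ → ∃ R : RatFn (Fin (n+1)),
      ∀ z : Fin (n+1) → ℂ, OrderedPos z →
        AbsConvTo (fun k : Fin (n+1) → ℤ =>
            φ (YR w (compApply n (fun i x => A.Y (v i.castSucc) x (k i.succ))
                (v (Fin.last n))) (k 0)) * ∏ i, z i ^ (-(k i) - 1))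
          (R.eval z)
  /-- rationality of iterates and associativity for the right vertex operator map -/
  associativityR : ∀ (w : W) (u₁ u₂ : V) (φ : W →ₗ[ℂ] ℂ), InGradedDual gr.proj φ →
    ∃ R : RatFn (Fin 2),
      (∀ z₁ z₂ : ℂ, ‖z₂‖ < ‖z₁‖ → 0 < ‖z₂‖ →
        AbsConvTo (fun k : ℤ × ℤ =>
            φ (YR w (A.Y u₁ u₂ k.2) k.1) * z₁ ^ (-k.1 - 1) * z₂ ^ (-k.2 - 1))
          (R.eval ![z₁, z₂])) ∧
      (∀ z₁ z₂ : ℂ, ‖z₁ - z₂‖ < ‖z₂‖ → 0 < ‖z₁ - z₂‖ →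
        AbsConvTo (fun k : ℤ × ℤ =>
            φ (YR (YR w u₁ k.1) u₂ k.2) * (z₁ - z₂) ^ (-k.1 - 1) * z₂ ^ (-k.2 - 1))
          (R.eval ![z₁, z₂]))
  /-- compatibility: rationality of mixed products
  `Y_W^L(u₁,z₁)⋯Y_W^L(u_p,z_p)Y_W^R(w,z₀)Y_V(v₁,⋅)⋯Y_V(v_{q},⋅)v_{q+1}` -/
  compatRat : ∀ (p q : ℕ) (u : Fin p → V) (w : W) (v : Fin (q+1) → V)
      (φ : W →ₗ[ℂ] ℂ), InGradedDual gr.proj φ →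
    ∃ R : RatFn (Fin p ⊕ Fin (q+1)),
      ∀ (zL : Fin p → ℂ) (z0 : ℂ) (zR : Fin q → ℂ),
        Ordered zL → (∀ i, ‖z0‖ < ‖zL i‖) → (∀ j, ‖zR j‖ < ‖z0‖) → Ordered zR →
        0 < ‖z0‖ → (∀ j, 0 < ‖zR j‖) →
        AbsConvTo (fun K : (Fin p → ℤ) × ℤ × (Fin q → ℤ) =>
            φ (compApply p (fun i x => YL (u i) x (K.1 i))
                (YR w (compApply q (fun j x => A.Y (v j.castSucc) x (K.2.2 j))
                  (v (Fin.last q))) K.2.1))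
              * (∏ i, zL i ^ (-(K.1 i) - 1)) * z0 ^ (-K.2.1 - 1)
              * ∏ j, zR j ^ (-(K.2.2 j) - 1))
          (R.eval (Sum.elim zL (Fin.cons z0 zR)))
  /-- compatibility: associativity for the left and right vertex operator maps -/
  compatAssoc : ∀ (u v : V) (w : W) (φ : W →ₗ[ℂ] ℂ), InGradedDual gr.proj φ →
    ∃ R : RatFn (Fin 2),
      (∀ z₁ z₂ : ℂ, ‖z₂‖ < ‖z₁‖ → 0 < ‖z₂‖ →
        AbsConvTo (fun k : ℤ × ℤ =>
            φ (YL u (YR w v k.2) k.1) * z₁ ^ (-k.1 - 1) * z₂ ^ (-k.2 - 1))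
          (R.eval ![z₁, z₂])) ∧
      (∀ z₁ z₂ : ℂ, ‖z₁ - z₂‖ < ‖z₂‖ → 0 < ‖z₁ - z₂‖ →
        AbsConvTo (fun k : ℤ × ℤ =>
            φ (YR (YL u w k.1) v k.2) * (z₁ - z₂) ^ (-k.1 - 1) * z₂ ^ (-k.2 - 1))
          (R.eval ![z₁, z₂]))

variable {W : Type*} [AddCommGroup W] [Module ℂ W] {A : MOSVA V}

/-- The opposite right vertex operator map
`Y_W^{s(R)}(v,x)w = e^{xD_W}Y_W^R(w,-x)v`, through its coefficients. -/
def Bimod.YsR (B : Bimod A W) (v : V) (w : W) (k : ℤ) : W :=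
  ∑ᶠ m : ℕ, (((-1 : ℂ) ^ (k + (m : ℤ) + 1)) * ((m.factorial : ℂ))⁻¹) •
    ((B.DW ^ m) (B.YR w v (k + (m : ℤ))))

/-- The pole-order condition for a bimodule over a MOSVA. -/
def Bimod.PoleOrder (B : Bimod A W) : Prop :=
  (∀ (u₁ : V) (w : W), ∃ C : ℕ, ∀ φ : W →ₗ[ℂ] ℂ, InGradedDual B.gr.proj φ → ∀ u₂ : V,
    ∃ R : RatFn (Fin 2), R.a 0 ≤ C ∧
      ∀ z₁ z₂ : ℂ, ‖z₂‖ < ‖z₁‖ → 0 < ‖z₂‖ →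
        AbsConvTo (fun k : ℤ × ℤ =>
            φ (B.YL u₁ (B.YL u₂ w k.2) k.1) * z₁ ^ (-k.1 - 1) * z₂ ^ (-k.2 - 1))
          (R.eval ![z₁, z₂])) ∧
  (∀ (u₂ : V) (w : W), ∃ C : ℕ, ∀ φ : W →ₗ[ℂ] ℂ, InGradedDual B.gr.proj φ → ∀ u₁ : V,
    ∃ R : RatFn (Fin 2), R.a 0 ≤ C ∧
      ∀ z₁ z₂ : ℂ, ‖z₂‖ < ‖z₁‖ → 0 < ‖z₂‖ →
        AbsConvTo (fun k : ℤ × ℤ =>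
            φ (B.YR w (A.Y u₁ u₂ k.2) k.1) * z₁ ^ (-k.1 - 1) * z₂ ^ (-k.2 - 1))
          (R.eval ![z₁, z₂])) ∧
  (∀ (u₁ u₂ : V), ∃ C : ℕ, ∀ φ : W →ₗ[ℂ] ℂ, InGradedDual B.gr.proj φ → ∀ w : W,
    ∃ R : RatFn (Fin 2), R.a 0 ≤ C ∧
      ∀ z₁ z₂ : ℂ, ‖z₂‖ < ‖z₁‖ → 0 < ‖z₂‖ →
        AbsConvTo (fun k : ℤ × ℤ =>
            φ (B.YL u₁ (B.YR w u₂ k.2) k.1) * z₁ ^ (-k.1 - 1) * z₂ ^ (-k.2 - 1))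
          (R.eval ![z₁, z₂]))

end VOA


section Cochains

variable {V : Type*} [AddCommGroup V] [Module ℂ V]
variable {W : Type*} [AddCommGroup W] [Module ℂ W] {A : MOSVA V}

/-- A `W̄`-valued rational function in the variables `z i`, `i : ι`, with the only
possible poles at `z i = z j`: a map from configuration space to the algebraic
completion whose pairings with graded-dual functionals are such rational functions,
with pole orders uniform in the functional, as witnessed by a formal power series
with coefficients in `W` (condition (ii)). -/
def CGrading.WTilde (G : CGrading W) {ι : Type*} [Fintype ι] [DecidableEq ι]
    (f : (ι → ℂ) → G.Comp) : Prop :=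
  (∀ φ : W →ₗ[ℂ] ℂ, InGradedDual G.proj φ →
      ∃ R : DiagRatFn ι, ∀ z : ι → ℂ, Conf z → G.pair φ (f z) = R.eval z) ∧
  ∃ (p : ι → ι → ℤ) (b : (ι → ℕ) → W),
    ∀ φ : W →ₗ[ℂ] ℂ, InGradedDual G.proj φ →
      (Function.support fun k => φ (b k)).Finite ∧
      ∀ z : ι → ℂ, Conf z →
        (∏ q ∈ Finset.univ.offDiag, (z q.1 - z q.2) ^ (p q.1 q.2)) * G.pair φ (f z)
          = ∑ᶠ k : ι → ℕ, φ (b k) * ∏ i, z i ^ (k i)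

/-- The pattern of left/right vertex operators: the `i`-th operator is
`Y_W^L(u i, z i)` if `isL i`, and `Y_W^{s(R)}(u i, z i)` otherwise; `k` records the
coefficient extracted from each operator. -/
def patOps (B : Bimod A W) {n : ℕ} (isL : Fin n → Bool) (u : Fin n → V)
    (k : Fin n → ℤ) : Fin n → (W → W) :=
  fun i => if isL i then fun x => B.YL (u i) x (k i) else fun x => B.YsR (u i) x (k i)

/-- The pattern with `l` left operators followed by `n - l` opposite right operators. -/
def prefixPat (n l : ℕ) : Fin n → Bool := fun i => decide ((i : ℕ) < l)

/-- A vector `w` such that `Y_W^L(u,x)w ∈ W[[x]]` and `Y_W^{s(R)}(u,x)w ∈ W[[x]]`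
for every `u ∈ V`. -/
def Bimod.RegVec (B : Bimod A W) (w : W) : Prop :=
  ∀ (u : V) (k : ℤ), 0 ≤ k → B.YL u w k = 0 ∧ B.YsR u w k = 0

/-- `f` represents the `W̄`-valued rational function
`E(Y^{L/sR}(u 0, z 0)⋯Y^{L/sR}(u (n-1), z (n-1)) w)` (with the operators prescribed
by the pattern `isL`): `f` is a `W̄`-valued rational function with only diagonal
poles whose pairings are the sums of the corresponding series of matrix coefficients
on the region `|z 0| > ⋯ > |z (n-1)| > 0`. -/
def RepEPat (B : Bimod A W) {n : ℕ} (isL : Fin n → Bool) (u : Fin n → V) (w : W)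
    (f : (Fin n → ℂ) → B.gr.Comp) : Prop :=
  B.gr.WTilde f ∧
  ∀ φ : W →ₗ[ℂ] ℂ, InGradedDual B.gr.proj φ → ∀ z : Fin n → ℂ, OrderedPos z →
    AbsConvTo (fun k : Fin n → ℤ =>
        φ (compApply n (patOps B isL u k) w) * ∏ i, z i ^ (-(k i) - 1))
      (B.gr.pair φ (f z))

/-- `f` represents the `W̄`-valued rational function given by a product of groups of
vertex operators, with group `i` of size `α i` and left/right pattern `isL`;
the variables are indexed by the sigma type `(i : Fin N) × Fin (α i)`. -/
def RepESig (B : Bimod A W) {N : ℕ} (α : Fin N → ℕ)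
    (isL : (i : Fin N) → Fin (α i) → Bool)
    (u : (i : Fin N) → Fin (α i) → V) (w : W)
    (f : (((i : Fin N) × Fin (α i)) → ℂ) → B.gr.Comp) : Prop :=
  B.gr.WTilde f ∧
  ∀ φ : W →ₗ[ℂ] ℂ, InGradedDual B.gr.proj φ →
    ∀ Z : (i : Fin N) → Fin (α i) → ℂ,
      (∀ (i : Fin N) (s t : Fin (α i)), s < t → ‖Z i t‖ < ‖Z i s‖) →
      (∀ (i j : Fin N), i < j → ∀ (s : Fin (α i)) (t : Fin (α j)), ‖Z j t‖ < ‖Z i s‖) →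
      (∀ (i : Fin N) (s : Fin (α i)), 0 < ‖Z i s‖) →
      AbsConvTo (fun K : (i : Fin N) → Fin (α i) → ℤ =>
          φ (compApply N (fun i x => compApply (α i) (fun s y =>
              if isL i s then B.YL (u i s) y (K i s) else B.YsR (u i s) y (K i s)) x) w)
            * ∏ i, ∏ s, Z i s ^ (-(K i s) - 1))
        (B.gr.pair φ (f (fun q => Z q.1 q.2)))

/-- Multilinearity of a map on `n`-tuples of vectors. -/
def IsMultilinear {M : Type*} [AddCommMonoid M] [Module ℂ M] {n : ℕ}
    (Φ : (Fin n → V) → M) : Prop :=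
  (∀ (v : Fin n → V) (i : Fin n) (x y : V),
      Φ (Function.update v i (x + y)) = Φ (Function.update v i x) + Φ (Function.update v i y)) ∧
  ∀ (v : Fin n → V) (i : Fin n) (c : ℂ) (x : V),
      Φ (Function.update v i (c • x)) = c • Φ (Function.update v i x)

/-- The `D`-derivative property of a map `Φ : V^{⊗n} → W̃_{z₁,…,zₙ}`. -/
def DDerivProp (A : MOSVA V) (B : Bimod A W) {n : ℕ}
    (Φ : (Fin n → V) → (Fin n → ℂ) → B.gr.Comp) : Prop :=
  (∀ (v : Fin n → V) (i : Fin n) (φ : W →ₗ[ℂ] ℂ), InGradedDual B.gr.proj φ →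
    ∀ z : Fin n → ℂ, Conf z →
      HasDerivAt (fun t : ℂ => B.gr.pair φ (Φ v (Function.update z i t)))
        (B.gr.pair φ (Φ (Function.update v i (A.D (v i))) z)) (z i)) ∧
  (∀ (v : Fin n → V) (φ : W →ₗ[ℂ] ℂ), InGradedDual B.gr.proj φ →
    ∀ z : Fin n → ℂ, Conf z →
      B.gr.pair φ (B.gr.ext (⇑B.DW) (Φ v z)) =
        ∑ i, B.gr.pair φ (Φ (Function.update v i (A.D (v i))) z))

/-- The `d`-conjugation property of a map `Φ : V^{⊗n} → W̃_{z₁,…,zₙ}`. -/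
def DConjProp (A : MOSVA V) (B : Bimod A W) {n : ℕ}
    (Φ : (Fin n → V) → (Fin n → ℂ) → B.gr.Comp) : Prop :=
  ∀ (v : Fin n → V) (φ : W →ₗ[ℂ] ℂ), InGradedDual B.gr.proj φ →
    ∀ (z : Fin n → ℂ) (c : ℂ), c ≠ 0 → Conf z → Conf (fun i => c * z i) →
      B.gr.pair φ (B.gr.zd c (Φ v z)) =
        B.gr.pair φ (Φ (fun i => A.gr.zd c (v i)) (fun i => c * z i))

/-- Composability of `Φ : V^{⊗n} → W̃` with `m` vertex operators. -/
def ComposableWith (A : MOSVA V) (B : Bimod A W) (n m : ℕ)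
    (Φ : (Fin n → V) → (Fin n → ℂ) → B.gr.Comp) : Prop :=
  ∃ Cb : V → V → ℕ,
  ∀ (α : Fin (n+1) → ℕ), (∑ i, α i) = m + n →
  ∀ l₀ : ℕ, l₀ ≤ α 0 →
  ∀ u : (i : Fin (n+1)) → Fin (α i) → V,
  ∀ φ : W →ₗ[ℂ] ℂ, InGradedDual B.gr.proj φ →
  ∃ R : DiagRatFn ((i : Fin (n+1)) × Fin (α i)),
    (∀ q q' : (i : Fin (n+1)) × Fin (α i), R.b q q' ≤ Cb (u q.1 q.2) (u q'.1 q'.2)) ∧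
    ∀ (z : (i : Fin (n+1)) → Fin (α i) → ℂ) (ζ : Fin n → ℂ),
      (∀ s t : Fin (α 0), s < t → ‖z 0 t‖ < ‖z 0 s‖) →
      (∀ (j : Fin (α 0)) (i : Fin n) (t : Fin (α i.succ)),
          ‖ζ i‖ + ‖z i.succ t - ζ i‖ < ‖z 0 j‖) →
      (∀ (i : Fin n) (s t : Fin (α i.succ)), s < t →
          ‖z i.succ t - ζ i‖ < ‖z i.succ s - ζ i‖) →
      (∀ (i j : Fin n), i < j → ∀ (s : Fin (α i.succ)) (t : Fin (α j.succ)),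
          ‖(z i.succ s - ζ i) - (z j.succ t - ζ j)‖ < ‖ζ i - ζ j‖) →
      AbsConvTo (fun K : (i : Fin (n+1)) → Fin (α i) → ℤ =>
          B.gr.pair φ
            (compApply (α 0) (fun j => B.gr.ext (fun x =>
                if (j : ℕ) < l₀ then B.YL (u 0 j) x (K 0 j) else B.YsR (u 0 j) x (K 0 j)))
              (Φ (fun i => compApply (α i.succ)
                    (fun s x => A.Y (u i.succ s) x (K i.succ s)) A.vac) ζ))
            * (∏ j, z 0 j ^ (-(K 0 j) - 1))
            * ∏ i : Fin n, ∏ s, (z i.succ s - ζ i) ^ (-(K i.succ s) - 1))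
        (R.eval (fun q => z q.1 q.2))

/-- The set `Ĉ^n_m(V,W)`: maps `V^{⊗n} → W̃_{z₁,…,zₙ}` that are linear, satisfy the
`D`-derivative and `d`-conjugation properties and are composable with `m` vertex
operators. -/
def IsCochain (A : MOSVA V) (B : Bimod A W) (n m : ℕ)
    (Φ : (Fin n → V) → (Fin n → ℂ) → B.gr.Comp) : Prop :=
  IsMultilinear Φ ∧ (∀ v, B.gr.WTilde (Φ v)) ∧ DDerivProp A B Φ ∧ DConjProp A B Φ ∧
    ComposableWith A B n m Φ

/-- `Ψ` represents `E_W^{(1,0)} ∘₂ Φ`, i.e. the map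
`v ↦ E(Y_W^L(v 0, z 0) Φ(v 1 ⊗ ⋯ ⊗ v n)(z 1,…,z n))`. -/
def RepLeft (A : MOSVA V) (B : Bimod A W) {n : ℕ}
    (Φ : (Fin n → V) → (Fin n → ℂ) → B.gr.Comp)
    (Ψ : (Fin (n+1) → V) → (Fin (n+1) → ℂ) → B.gr.Comp) : Prop :=
  (∀ v, B.gr.WTilde (Ψ v)) ∧
  ∀ (v : Fin (n+1) → V) (φ : W →ₗ[ℂ] ℂ), InGradedDual B.gr.proj φ →
    ∀ (z₀ : ℂ) (zt : Fin n → ℂ), Conf (Fin.cons z₀ zt) →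
      (∀ i, ‖zt i‖ < ‖z₀‖) → (∀ i, 0 < ‖zt i‖) →
      AbsConvTo (fun k : ℤ =>
          B.gr.pair φ (B.gr.ext (fun x => B.YL (v 0) x k) (Φ (Fin.tail v) zt))
            * z₀ ^ (-k - 1))
        (B.gr.pair φ (Ψ v (Fin.cons z₀ zt)))

/-- `Ψ` represents `E_W^{(0,1)} ∘₂ Φ`, i.e. the map
`v ↦ E(Y_W^{s(R)}(v (n+1), z (n+1)) Φ(v 1 ⊗ ⋯ ⊗ v n)(z 1,…,z n))`. -/
def RepRight (A : MOSVA V) (B : Bimod A W) {n : ℕ}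
    (Φ : (Fin n → V) → (Fin n → ℂ) → B.gr.Comp)
    (Ψ : (Fin (n+1) → V) → (Fin (n+1) → ℂ) → B.gr.Comp) : Prop :=
  (∀ v, B.gr.WTilde (Ψ v)) ∧
  ∀ (v : Fin (n+1) → V) (φ : W →ₗ[ℂ] ℂ), InGradedDual B.gr.proj φ →
    ∀ (zl : ℂ) (zi : Fin n → ℂ), Conf (Fin.snoc zi zl) →
      (∀ i, ‖zi i‖ < ‖zl‖) → (∀ i, 0 < ‖zi i‖) →
      AbsConvTo (fun k : ℤ =>
          B.gr.pair φ (B.gr.ext (fun x => B.YsR (v (Fin.last n)) x k) (Φ (Fin.init v) zi))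
            * zl ^ (-k - 1))
        (B.gr.pair φ (Ψ v (Fin.snoc zi zl)))

/-- Replace the two adjacent entries `i, i+1` of an `(n+1)`-tuple by a single entry. -/
def mergeAt {M : Type*} {n : ℕ} (i : Fin n) (v : Fin (n+1) → M) (a : M) : Fin n → M :=
  fun j => if j < i then v j.castSucc else if j = i then a else v j.succ

/-- `Ψ` represents `Φ ∘ᵢ E_V^{(2)}`, i.e. the map
`v ↦ E(Φ(v 1 ⊗ ⋯ ⊗ Y_V(v i, z i − ζ)Y_V(v (i+1), z (i+1) − ζ)𝟏 ⊗ ⋯ ⊗ v (n+1))(…,ζ,…))`. -/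
def RepCirc (A : MOSVA V) (B : Bimod A W) {n : ℕ} (i : Fin n)
    (Φ : (Fin n → V) → (Fin n → ℂ) → B.gr.Comp)
    (Ψ : (Fin (n+1) → V) → (Fin (n+1) → ℂ) → B.gr.Comp) : Prop :=
  (∀ v, B.gr.WTilde (Ψ v)) ∧
  ∀ (v : Fin (n+1) → V) (φ : W →ₗ[ℂ] ℂ), InGradedDual B.gr.proj φ →
    ∀ (z : Fin (n+1) → ℂ) (ζ : ℂ), Conf z → Conf (mergeAt i z ζ) →
      ‖z i.succ - ζ‖ < ‖z i.castSucc - ζ‖ → 0 < ‖z i.succ - ζ‖ →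
      (∀ j : Fin (n+1), j ≠ i.castSucc → j ≠ i.succ →
        ‖z i.castSucc - ζ‖ < ‖z j - z i.castSucc‖ ∧ ‖z i.succ - ζ‖ < ‖z j - z i.succ‖) →
      AbsConvTo (fun k : ℤ × ℤ =>
          B.gr.pair φ
            (Φ (mergeAt i v (A.Y (v i.castSucc) (A.Y (v i.succ) A.vac k.2) k.1))
              (mergeAt i z ζ))
            * (z i.castSucc - ζ) ^ (-k.1 - 1) * (z i.succ - ζ) ^ (-k.2 - 1))
        (B.gr.pair φ (Ψ v z))

/-- `Ψ` represents the coboundary `δ̂Φ = E_W^{(1,0)}∘₂Φ + Σᵢ (−1)^i Φ∘ᵢE_V^{(2)}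
+ (−1)^{n+1} E_W^{(0,1)}∘₂Φ` of the `n`-cochain `Φ`. -/
def IsDelta (A : MOSVA V) (B : Bimod A W) {n : ℕ}
    (Φ : (Fin n → V) → (Fin n → ℂ) → B.gr.Comp)
    (Ψ : (Fin (n+1) → V) → (Fin (n+1) → ℂ) → B.gr.Comp) : Prop :=
  ∃ (gL gR : (Fin (n+1) → V) → (Fin (n+1) → ℂ) → B.gr.Comp)
    (gC : Fin n → (Fin (n+1) → V) → (Fin (n+1) → ℂ) → B.gr.Comp),
    RepLeft A B Φ gL ∧ RepRight A B Φ gR ∧ (∀ i, RepCirc A B i Φ (gC i)) ∧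
    ∀ v z, Ψ v z = gL v z + (∑ i : Fin n, ((-1 : ℂ) ^ ((i : ℕ) + 1)) • gC i v z)
      + ((-1 : ℂ) ^ (n + 1)) • gR v z

end Cochains

theorem absConvTo_iff {ι : Type*} {f : ι → ℂ} {s : ℂ} : AbsConvTo f s ↔ HasSum f s :=
  ⟨fun h => h.2, fun h => ⟨h.summable.norm, h⟩⟩

/-- The normalized Haar measure on a torus. -/
def torusMeasure (ι : Type*) [Fintype ι] : MeasureTheory.Measure (UnitAddTorus ι) :=
  MeasureTheory.Measure.pi fun _ => AddCircle.haarAddCircle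

instance (ι : Type*) [Fintype ι] : MeasureTheory.IsProbabilityMeasure (torusMeasure ι) :=
  inferInstanceAs (MeasureTheory.IsProbabilityMeasure (MeasureTheory.Measure.pi _))

theorem integral_mFourier_mul {ι : Type*} [Fintype ι] [DecidableEq (ι → ℤ)] (J K : ι → ℤ) :
    ∫ x, UnitAddTorus.mFourier (-J) x * UnitAddTorus.mFourier K x ∂torusMeasure ι =
      if J = K then 1 else 0 := by
  have h := orthonormal_iff_ite.1 (UnitAddTorus.orthonormal_mFourier (d := ι)) J K
  rw [MeasureTheory.ContinuousMap.inner_toLp] at h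
  simp_rw [← UnitAddTorus.mFourier_neg, mul_comm (UnitAddTorus.mFourier K _)] at h
  exact h

/-- A summable Fourier series on a torus which vanishes identically has zero coefficients. -/
theorem eq_zero_of_hasSum_mFourier {ι : Type*} [Fintype ι] {c : (ι → ℤ) → ℂ}
    (h : ∀ x : UnitAddTorus ι, HasSum (fun K => c K * UnitAddTorus.mFourier K x) 0) : c = 0 := by
  classical
  funext J
  let F : (ι → ℤ) → C(UnitAddTorus ι, ℂ) :=
    fun K => UnitAddTorus.mFourier (-J) * c K • UnitAddTorus.mFourier K
  have hF : ∀ K x, ‖F K x‖ = ‖c K‖ := fun K x => by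
    simp only [F, UnitAddTorus.mFourier, fourier_apply, ContinuousMap.mul_apply,
      ContinuousMap.smul_apply, ContinuousMap.coe_mk, norm_mul, norm_smul, norm_prod,
      Circle.norm_coe, Finset.prod_const_one, one_mul, mul_one]
  have hc : Summable fun K => ‖c K‖ := by
    have h0 := (h 0).summable.norm
    simpa [UnitAddTorus.mFourier] using h0
  have h1 := MeasureTheory.hasSum_integral_of_summable_integral_norm
    (μ := torusMeasure ι)
    (F := fun K x => F K x)
    (fun K => (F K).continuous.integrable_of_hasCompactSupport
      (HasCompactSupport.of_compactSpace _))
    (by simpa [hF] using hc)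
  have h2 : ∀ x, ∑' K, F K x = 0 := fun x => by
    have := (h x).mul_left (UnitAddTorus.mFourier (-J) x)
    rw [mul_zero] at this
    exact this.tsum_eq
  have h3 : ∀ K, ∫ x, F K x ∂torusMeasure ι = if K = J then c J else 0 := fun K => by
    have : ∀ x, F K x = c K * (UnitAddTorus.mFourier (-J) x * UnitAddTorus.mFourier K x) :=
      fun x => by simp only [F, ContinuousMap.mul_apply, ContinuousMap.smul_apply, smul_eq_mul]; ring
    simp_rw [this]
    rw [MeasureTheory.integral_const_mul, integral_mFourier_mul]
    by_cases hJ : K = J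
    · simp [hJ]
    · simp [hJ, Ne.symm hJ]
  simp only [h2, h3, MeasureTheory.integral_zero] at h1
  exact (hasSum_ite_eq J (c J)).unique h1

theorem laurent_coeff_unique {ι : Type*} [Fintype ι] {a b : (ι → ℤ) → ℂ} {F : (ι → ℂ) → ℂ}
    (r : ι → ℝ) (hr : ∀ i, 0 < r i)
    (ha : ∀ z : ι → ℂ, (∀ i, ‖z i‖ = r i) → HasSum (fun K => a K * ∏ i, z i ^ K i) (F z))
    (hb : ∀ z : ι → ℂ, (∀ i, ‖z i‖ = r i) → HasSum (fun K => b K * ∏ i, z i ^ K i) (F z)) :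
    a = b := by
  have h0 : (fun K => (a K - b K) * ∏ i, (r i : ℂ) ^ K i) = 0 := by
    refine eq_zero_of_hasSum_mFourier fun x => ?_
    have hz : ∀ i, ‖(r i : ℂ) * (AddCircle.toCircle (x i) : ℂ)‖ = r i := fun i => by
      rw [norm_mul, Circle.norm_coe]; simp [abs_of_pos (hr i)]
    have := (ha _ hz).sub (hb _ hz)
    rw [sub_self] at this
    refine (congrArg (HasSum · (0 : ℂ)) ?_).mpr this
    funext K
    simp only [UnitAddTorus.mFourier, ContinuousMap.coe_mk, fourier_apply,
      AddCircle.toCircle_zsmul, mul_zpow, Finset.prod_mul_distrib, Circle.coe_zpow]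
    ring
  funext K
  have := congrFun h0 K
  have hne : ∏ i, (r i : ℂ) ^ K i ≠ 0 :=
    Finset.prod_ne_zero_iff.2 fun i _ => zpow_ne_zero _ (by exact_mod_cast (hr i).ne')
  simpa [hne, sub_eq_zero] using this

theorem hasSum_mul {I J : Type*} {f : I → ℂ} {g : J → ℂ} {s t : ℂ} (hf : HasSum f s)
    (hg : HasSum g t) : HasSum (fun x : I × J => f x.1 * g x.2) (s * t) :=
  HasSum.mul hf hg (summable_mul_of_summable_norm (R := ℂ) hf.summable.norm hg.summable.norm)

/-- `F` is, on `S`, the sum of an absolutely convergent series of Laurent monomials whose total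
degrees are bounded above and whose negative exponents occur only in variables that do not vanish
on `S`. -/
def LaurentExpandable {ι : Type} [Fintype ι] (S : Set (ι → ℂ)) (F : (ι → ℂ) → ℂ) : Prop :=
  ∃ (I : Type) (a : I → ℂ) (κ : I → ι → ℤ) (d : ℤ),
    (∀ x, ∑ j, κ x j ≤ d) ∧ (∀ x j, 0 ≤ κ x j ∨ ∀ z ∈ S, z j ≠ 0) ∧
    ∀ z ∈ S, HasSum (fun x => a x * ∏ j, z j ^ κ x j) (F z)

namespace LaurentExpandable

variable {ι : Type} [Fintype ι] {S : Set (ι → ℂ)} {F G : (ι → ℂ) → ℂ}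

theorem congr (hF : LaurentExpandable S F) (h : ∀ z ∈ S, F z = G z) : LaurentExpandable S G := by
  obtain ⟨I, a, κ, d, hd, hκ, hs⟩ := hF
  exact ⟨I, a, κ, d, hd, hκ, fun z hz => h z hz ▸ hs z hz⟩

theorem mul (hF : LaurentExpandable S F) (hG : LaurentExpandable S G) :
    LaurentExpandable S fun z => F z * G z := by
  obtain ⟨I, a, κ, d, hd, hκ, hs⟩ := hF
  obtain ⟨I', a', κ', d', hd', hκ', hs'⟩ := hG
  refine ⟨I × I', fun x => a x.1 * a' x.2, fun x j => κ x.1 j + κ' x.2 j, d + d', fun x => ?_,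
    fun x j => ?_, fun z hz => ?_⟩
  · rw [Finset.sum_add_distrib]
    exact add_le_add (hd _) (hd' _)
  · rcases hκ x.1 j with h | h
    · rcases hκ' x.2 j with h' | h'
      · exact Or.inl (add_nonneg h h')
      · exact Or.inr h'
    · exact Or.inr h
  · refine (congrArg (HasSum · _) (funext fun x => ?_)).mpr (hasSum_mul (hs z hz) (hs' z hz))
    have hz' : ∀ j, z j ^ (κ x.1 j + κ' x.2 j) = z j ^ κ x.1 j * z j ^ κ' x.2 j := fun j => by
      by_cases h0 : z j = 0
      · have h1 := (hκ x.1 j).resolve_right fun h => h z hz h0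
        have h2 := (hκ' x.2 j).resolve_right fun h => h z hz h0
        lift κ x.1 j to ℕ using h1 with k
        lift κ' x.2 j to ℕ using h2 with k'
        exact_mod_cast pow_add (z j) k k'
      · exact zpow_add₀ h0 _ _
    simp_rw [hz', Finset.prod_mul_distrib]
    ring

theorem eval_mvPolynomial (P : MvPolynomial ι ℂ) :
    LaurentExpandable S fun z => MvPolynomial.eval z P := by
  refine ⟨P.support, fun x => P.coeff x, fun x j => (x.1 j : ℤ), P.totalDegree, fun x => ?_,
    fun x j => Or.inl (Int.natCast_nonneg _), fun z _ => ?_⟩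
  · have := MvPolynomial.le_totalDegree x.2
    rw [Finsupp.sum_fintype _ _ fun _ => rfl] at this
    simpa using (Nat.cast_le (α := ℤ)).2 this
  · simp only [MvPolynomial.eval_eq', zpow_natCast]
    rw [← Finset.sum_coe_sort]
    exact hasSum_fintype _

theorem one : LaurentExpandable S fun _ => 1 := by
  simpa using eval_mvPolynomial (S := S) (1 : MvPolynomial ι ℂ)

theorem pow (hF : LaurentExpandable S F) (n : ℕ) : LaurentExpandable S fun z => F z ^ n := by
  induction n with
  | zero => simpa using one
  | succ n ih => simpa only [pow_succ] using ih.mul hF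

theorem prod {α : Type*} (s : Finset α) {F : α → (ι → ℂ) → ℂ}
    (h : ∀ q ∈ s, LaurentExpandable S (F q)) : LaurentExpandable S fun z => ∏ q ∈ s, F q z := by
  classical
  induction s using Finset.induction_on with
  | empty => simpa using one
  | insert q s hq ih =>
    simp only [Finset.prod_insert hq]
    exact (h q (Finset.mem_insert_self _ _)).mul
      (ih fun q' hq' => h q' (Finset.mem_insert_of_mem hq'))

theorem inv_sub {i j : ι} (h : ∀ z ∈ S, ‖z j‖ < ‖z i‖) :
    LaurentExpandable S fun z => (z i - z j)⁻¹ := by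
  classical
  by_cases hij : i = j
  · subst hij
    exact one.congr fun z hz => absurd (h z hz) (lt_irrefl _)
  have h0 : ∀ z ∈ S, z i ≠ 0 := fun z hz => norm_pos_iff.1 ((norm_nonneg _).trans_lt (h z hz))
  refine ⟨ℕ, fun _ => 1, fun k l => if l = j then (k : ℤ) else if l = i then -k - 1 else 0, -1,
    fun k => ?_, fun k l => ?_, fun z hz => ?_⟩
  · rw [Fintype.sum_eq_add i j hij fun l hl => by simp [hl.1, hl.2]]
    simp only [hij, if_true, if_false]
    linarith
  · by_cases hl : l = j
    · exact Or.inl (by simp [hl])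
    · by_cases hl' : l = i
      · exact Or.inr (hl' ▸ h0)
      · exact Or.inl (by simp [hl, hl'])
  · have hi := h0 z hz
    have hlt : ‖z j / z i‖ < 1 := by
      rw [norm_div, div_lt_one (norm_pos_iff.2 hi)]
      exact h z hz
    have hg := (hasSum_geometric_of_norm_lt_one hlt).mul_left (z i)⁻¹
    have he : (z i)⁻¹ * (1 - z j / z i)⁻¹ = (z i - z j)⁻¹ := by
      rw [← mul_inv, mul_sub, mul_one, mul_div_cancel₀ _ hi]
    rw [he] at hg
    refine (congrArg (HasSum · _) (funext fun k => ?_)).mpr hg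
    rw [Fintype.prod_eq_mul i j hij fun l hl => by simp [hl.1, hl.2]]
    simp only [hij, if_true, if_false, zpow_natCast, one_mul, div_pow]
    rw [zpow_sub₀ hi, zpow_neg, zpow_natCast, zpow_one]
    field_simp

theorem inv_sub' {i j : ι} (h : ∀ z ∈ S, ‖z j‖ < ‖z i‖) :
    LaurentExpandable S fun z => (z j - z i)⁻¹ := by
  refine ((eval_mvPolynomial (MvPolynomial.C (-1))).mul (inv_sub h)).congr fun z _ => ?_
  rw [MvPolynomial.eval_C, neg_one_mul, ← inv_neg, neg_sub]

/-- Collecting the terms with equal exponents. -/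
theorem exists_coeff (hF : LaurentExpandable S F) :
    ∃ (c : (ι → ℤ) → ℂ) (d : ℤ),
      (∀ k, c k ≠ 0 → ∑ j, k j ≤ d ∧ ∀ j, 0 ≤ k j ∨ ∀ z ∈ S, z j ≠ 0) ∧
      ∀ z ∈ S, HasSum (fun k => c k * ∏ j, z j ^ k j) (F z) := by
  obtain ⟨I, a, κ, d, hd, hκ, hs⟩ := hF
  refine ⟨fun k => ∑' x : κ ⁻¹' {k}, a x, d, fun k hk => ?_, fun z hz => ?_⟩
  · obtain ⟨⟨x, rfl⟩, -⟩ : ∃ x : κ ⁻¹' {k}, a x ≠ 0 := by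
      by_contra! h
      exact hk (by simp [h])
    exact ⟨hd x, hκ x⟩
  · refine (congrArg (HasSum · _) (funext fun k => ?_)).mpr ((hs z hz).tsum_fiberwise κ)
    rw [← tsum_mul_right]
    exact tsum_congr fun x => by rw [show κ x = k from x.2]

end LaurentExpandable

/-- The points of `ℂ^(m+n)` whose first `m` coordinates decrease strictly in norm and dominate
the other ones. -/
def dominatedRegion (m n : ℕ) : Set (Fin (m + n) → ℂ) :=
  {z | ∀ i j : Fin (m + n), i < j → (i : ℕ) < m → ‖z j‖ < ‖z i‖}

theorem append_mem_dominatedRegion {m n : ℕ} {zo : Fin m → ℂ} {zt : Fin n → ℂ}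
    (ho : Ordered zo) (hot : ∀ i j, ‖zt j‖ < ‖zo i‖) :
    Fin.append zo zt ∈ dominatedRegion m n := by
  intro i j hij hi
  induction i using Fin.addCases with
  | right i => simp at hi
  | left i =>
    induction j using Fin.addCases with
    | left j => simpa using ho i j (Fin.lt_def.2 hij)
    | right j => simpa using hot i j

theorem orderedPos_append {m n : ℕ} {zo : Fin m → ℂ} {zt : Fin n → ℂ}
    (ho : OrderedPos zo) (ht : OrderedPos zt) (hot : ∀ i j, ‖zt j‖ < ‖zo i‖) :
    OrderedPos (Fin.append zo zt) := by
  constructor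
  · intro i j hij
    induction i using Fin.addCases with
    | right i =>
      induction j using Fin.addCases with
      | left j => exact absurd hij (by simp [Fin.lt_def]; omega)
      | right j =>
        have := Fin.lt_def.1 hij
        simp only [Fin.val_natAdd] at this
        simpa using ht.1 i j (Fin.lt_def.2 (by omega))
    | left i => exact append_mem_dominatedRegion ho.1 hot _ j hij (by simp)
  · intro i
    induction i using Fin.addCases with
    | left i => simpa using ho.2 i
    | right i => simpa using ht.2 i

theorem OrderedPos.conf {n : ℕ} {z : Fin n → ℂ} (h : OrderedPos z) : Conf z := by
  intro i j hij he
  rcases lt_or_gt_of_ne hij with hlt | hlt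
  · exact absurd (h.1 _ _ hlt) (by simp [he])
  · exact absurd (h.1 _ _ hlt) (by simp [he])

/-- Radii `r 0 > r 1 > ⋯` exceeding the norms of all the coordinates of `zt`. -/
theorem exists_dominating_radii (m : ℕ) {n : ℕ} (zt : Fin n → ℂ) :
    ∃ r : Fin m → ℝ, (∀ i, 0 < r i) ∧ ∀ zo : Fin m → ℂ, (∀ i, ‖zo i‖ = r i) →
      OrderedPos zo ∧ ∀ i j, ‖zt j‖ < ‖zo i‖ := by
  have hpos : ∀ i : Fin m, (0 : ℝ) < m - i := fun i => by
    have : ((i : ℕ) : ℝ) < m := by exact_mod_cast i.2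
    linarith
  have hsum : 0 ≤ ∑ j, ‖zt j‖ := Finset.sum_nonneg fun _ _ => norm_nonneg _
  have hr : ∀ i : Fin m, 0 < ∑ j, ‖zt j‖ + (m - (i : ℕ)) := fun i => by linarith [hpos i]
  refine ⟨fun i => ∑ j, ‖zt j‖ + (m - (i : ℕ)), hr, fun zo hzo => ⟨⟨fun i j hij => ?_, fun i => ?_⟩,
    fun i j => ?_⟩⟩
  · have : ((i : ℕ) : ℝ) < (j : ℕ) := by exact_mod_cast hij
    rw [hzo, hzo]
    linarith
  · rw [hzo]
    exact hr i
  · rw [hzo]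
    have := Finset.single_le_sum (f := fun j => ‖zt j‖) (fun _ _ => norm_nonneg _)
      (Finset.mem_univ j)
    linarith [hpos i]

/-- On the region where the first `m` variables dominate, an expandable function has a Laurent
expansion in these variables with polynomial coefficients in the remaining ones. -/
theorem LaurentExpandable.exists_polynomial_coeff {m n : ℕ} {F : (Fin (m + n) → ℂ) → ℂ}
    (hF : LaurentExpandable (dominatedRegion m n) F) :
    ∃ p : (Fin m → ℤ) → MvPolynomial (Fin n) ℂ, ∀ (zo : Fin m → ℂ) (zt : Fin n → ℂ),
      Fin.append zo zt ∈ dominatedRegion m n →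
      HasSum (fun K => MvPolynomial.eval zt (p K) * ∏ i, zo i ^ K i) (F (Fin.append zo zt)) := by
  obtain ⟨c, d, hc, hs⟩ := hF.exists_coeff
  have hnn : ∀ k, c k ≠ 0 → ∀ j : Fin n, 0 ≤ k (Fin.natAdd m j) := fun k hk j => by
    refine ((hc k hk).2 (Fin.natAdd m j)).resolve_right fun h => ?_
    obtain ⟨r, hr0, hr⟩ := exists_dominating_radii m (0 : Fin n → ℂ)
    have hrr := hr (fun i => r i) fun i => by simp [abs_of_pos (hr0 i)]
    refine h _ (append_mem_dominatedRegion hrr.1.1 hrr.2) (by simp)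
  let E : (Fin m → ℤ) → Finset (Fin n → ℤ) := fun K =>
    Fintype.piFinset fun _ => Finset.Icc 0 (d - ∑ i, K i)
  have hE : ∀ K k, k ∉ E K → c (Fin.append K k) = 0 := fun K k hk => by
    by_contra hne
    refine hk (Fintype.mem_piFinset.2 fun j => Finset.mem_Icc.2 ?_)
    have hn : ∀ j, 0 ≤ k j := fun j => by simpa using hnn _ hne j
    have hle := (hc _ hne).1
    rw [Fin.sum_univ_add] at hle
    simp only [Fin.append_left, Fin.append_right] at hle
    have := Finset.single_le_sum (fun i _ => hn i) (Finset.mem_univ j)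
    exact ⟨hn j, by linarith⟩
  refine ⟨fun K => ∑ k ∈ E K, MvPolynomial.C (c (Fin.append K k)) *
    ∏ j, MvPolynomial.X j ^ (k j).toNat, fun zo zt hz => ?_⟩
  have h := (Fin.appendEquiv (α := ℤ) m n).hasSum_iff.2 (hs _ hz)
  refine h.prod_fiberwise fun K => ?_
  have hfin : HasSum _ _ := hasSum_sum_of_ne_finset_zero (f := fun k =>
    c (Fin.append K k) * ∏ j, Fin.append zo zt j ^ Fin.append K k j) (s := E K)
    fun k hk => by rw [hE K k hk, zero_mul]
  refine (congrArg (HasSum _) ?_).mpr hfin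
  simp only [map_sum, map_mul, map_prod, map_pow, MvPolynomial.eval_C, MvPolynomial.eval_X,
    Finset.sum_mul]
  refine Finset.sum_congr rfl fun k hk => ?_
  rw [Fin.prod_univ_add]
  simp only [Fin.append_left, Fin.append_right]
  have : ∀ j, zt j ^ k j = zt j ^ (k j).toNat := fun j => by
    have := (Finset.mem_Icc.1 (Fintype.mem_piFinset.1 hk j)).1
    rw [← zpow_natCast, Int.toNat_of_nonneg this]
  simp_rw [this]
  ring

/-- The involution `K ↦ -K - 1` exchanging the indices and the exponents of vertex operator
coefficients. -/
def residueExponents (m : ℕ) : (Fin m → ℤ) ≃ (Fin m → ℤ) :=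
  (Equiv.neg _).trans (Equiv.subRight 1)

theorem residueExponents_apply {m : ℕ} (K : Fin m → ℤ) (i : Fin m) :
    residueExponents m K i = -(K i) - 1 := rfl

theorem laurent_residueExponents_unique {m : ℕ} {a b : (Fin m → ℤ) → ℂ} {F : (Fin m → ℂ) → ℂ}
    (r : Fin m → ℝ) (hr : ∀ i, 0 < r i)
    (ha : ∀ z : Fin m → ℂ, (∀ i, ‖z i‖ = r i) →
      HasSum (fun K => a K * ∏ i, z i ^ (-(K i) - 1)) (F z))
    (hb : ∀ z : Fin m → ℂ, (∀ i, ‖z i‖ = r i) →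
      HasSum (fun K => b K * ∏ i, z i ^ (-(K i) - 1)) (F z)) :
    a = b := by
  let e := residueExponents m
  have key : ∀ {c : (Fin m → ℤ) → ℂ} {z : Fin m → ℂ},
      HasSum (fun K => c K * ∏ i, z i ^ (-(K i) - 1)) (F z) →
      HasSum (fun K => c (e K) * ∏ i, z i ^ K i) (F z) := fun {c z} h => by
    simpa [Function.comp_def, e, residueExponents] using e.hasSum_iff.2 h
  have h := laurent_coeff_unique r hr (fun z hz => key (ha z hz)) fun z hz => key (hb z hz)
  funext K
  simpa using congrFun h (e.symm K)

/-- The Laurent expansion of a rational function with diagonal poles in the region where the first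
`m` variables dominate. -/
theorem DiagRatFn.exists_expansion {m n : ℕ} (R : DiagRatFn (Fin (m + n))) :
    ∃ (p : (Fin m → ℤ) → MvPolynomial (Fin n) ℂ) (D : MvPolynomial (Fin n) ℂ),
      (∀ zt, Conf zt → MvPolynomial.eval zt D ≠ 0) ∧
      ∀ (zo : Fin m → ℂ) (zt : Fin n → ℂ), Conf zt → Fin.append zo zt ∈ dominatedRegion m n →
        HasSum (fun K => MvPolynomial.eval zt (p K) / MvPolynomial.eval zt D *
          ∏ i, zo i ^ (-(K i) - 1)) (R.eval (Fin.append zo zt)) := by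
  let s := (Finset.univ : Finset (Fin (m + n))).offDiag.filter fun q => m ≤ (q.1 : ℕ) ∧ m ≤ (q.2 : ℕ)
  let s' := (Finset.univ : Finset (Fin (m + n))).offDiag.filter
    fun q => ¬(m ≤ (q.1 : ℕ) ∧ m ≤ (q.2 : ℕ))
  let X : Fin (m + n) → MvPolynomial (Fin n) ℂ := Fin.append 0 MvPolynomial.X
  let D : MvPolynomial (Fin n) ℂ := ∏ q ∈ s, (X q.1 - X q.2) ^ R.b q.1 q.2
  have hX : ∀ (zo : Fin m → ℂ) (zt : Fin n → ℂ) (j : Fin (m + n)), m ≤ (j : ℕ) →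
      MvPolynomial.eval zt (X j) = Fin.append zo zt j := fun zo zt j hj => by
    induction j using Fin.addCases with
    | left j => exact absurd hj (not_le.2 j.2)
    | right j => simp [X]
  have hD : ∀ zo zt, MvPolynomial.eval zt D =
      ∏ q ∈ s, (Fin.append zo zt q.1 - Fin.append zo zt q.2) ^ R.b q.1 q.2 := fun zo zt => by
    simp only [D, map_prod, map_pow, map_sub]
    refine Finset.prod_congr rfl fun q hq => ?_
    have hq := (Finset.mem_filter.1 hq).2
    rw [hX zo zt _ hq.1, hX zo zt _ hq.2]
  have hF : LaurentExpandable (dominatedRegion m n) fun z => MvPolynomial.eval z R.num *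
      ∏ q ∈ s', (z q.1 - z q.2)⁻¹ ^ R.b q.1 q.2 := by
    refine (LaurentExpandable.eval_mvPolynomial _).mul (LaurentExpandable.prod _ fun q hq => ?_)
    obtain ⟨hne, hlt⟩ := Finset.mem_filter.1 hq
    have hne := (Finset.mem_offDiag.1 hne).2.2
    refine LaurentExpandable.pow ?_ _
    rcases lt_or_gt_of_ne hne with h | h
    · exact LaurentExpandable.inv_sub fun z hz => hz _ _ h (by have := Fin.lt_def.1 h; omega)
    · exact LaurentExpandable.inv_sub' fun z hz => hz _ _ h (by have := Fin.lt_def.1 h; omega)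
  obtain ⟨p, hp⟩ := hF.exists_polynomial_coeff
  refine ⟨p ∘ residueExponents m, D, fun zt hzt => ?_, fun zo zt hzt hz => ?_⟩
  · rw [hD 0 zt, Finset.prod_ne_zero_iff]
    intro q hq
    obtain ⟨hne, h1, h2⟩ := Finset.mem_filter.1 hq
    have hne := (Finset.mem_offDiag.1 hne).2.2
    refine pow_ne_zero _ (sub_ne_zero.2 ?_)
    obtain ⟨i, j⟩ := q
    dsimp only at h1 h2 hne ⊢
    induction i using Fin.addCases with
    | left i => exact absurd h1 (not_le.2 i.2)
    | right i =>
      induction j using Fin.addCases with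
      | left j => exact absurd h2 (not_le.2 j.2)
      | right j =>
        simpa using hzt i j fun h => hne (by rw [h])
  · have h := ((residueExponents m).hasSum_iff.2 (hp zo zt hz)).div_const (MvPolynomial.eval zt D)
    have hval : MvPolynomial.eval (Fin.append zo zt) R.num *
        (∏ q ∈ s', (Fin.append zo zt q.1 - Fin.append zo zt q.2)⁻¹ ^ R.b q.1 q.2) /
        MvPolynomial.eval zt D = R.eval (Fin.append zo zt) := by
      rw [DiagRatFn.eval, ← Finset.prod_filter_mul_prod_filter_not
        (Finset.univ : Finset (Fin (m + n))).offDiag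
        (fun q => m ≤ (q.1 : ℕ) ∧ m ≤ (q.2 : ℕ)), hD zo zt]
      simp only [inv_pow, Finset.prod_inv_distrib]
      rw [mul_comm (Finset.prod _ _), ← div_div, div_eq_mul_inv (MvPolynomial.eval _ _)]
    rw [← hval]
    refine (congrArg (HasSum · _) (funext fun K => ?_)).mpr h
    simp only [Function.comp_apply, residueExponents_apply]
    ring

theorem compApply_eq_foldr {M : Type*} (n : ℕ) (f : Fin n → M → M) (w : M) :
    compApply n f w = (List.ofFn f).foldr (fun h x => h x) w := by
  induction n with
  | zero => simp [compApply]
  | succ n ih => rw [compApply, ih, List.ofFn_succ, List.foldr_cons]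

theorem compApply_append {M : Type*} {m n : ℕ} (f : Fin m → M → M) (g : Fin n → M → M) (w : M) :
    compApply (m + n) (Fin.append f g) w = compApply m f (compApply n g w) := by
  simp only [compApply_eq_foldr, List.ofFn_fin_append, List.foldr_append]

/-- Rational functions with diagonal poles agreeing with a quotient of polynomials at the points
with decreasing nonzero norms agree with it on the whole configuration space. -/
theorem DiagRatFn.eval_eq_of_orderedPos {n : ℕ} (R : DiagRatFn (Fin n)) {P D : MvPolynomial (Fin n) ℂ}
    (hD : ∀ z, Conf z → MvPolynomial.eval z D ≠ 0)
    (h : ∀ z, OrderedPos z → R.eval z = MvPolynomial.eval z P / MvPolynomial.eval z D)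
    {z : Fin n → ℂ} (hz : Conf z) :
    R.eval z = MvPolynomial.eval z P / MvPolynomial.eval z D := by
  let Q : MvPolynomial (Fin n) ℂ := ∏ q ∈ (Finset.univ : Finset (Fin n)).offDiag,
    (MvPolynomial.X q.1 - MvPolynomial.X q.2) ^ R.b q.1 q.2
  have hQ : ∀ z, MvPolynomial.eval z Q =
      ∏ q ∈ (Finset.univ : Finset (Fin n)).offDiag, (z q.1 - z q.2) ^ R.b q.1 q.2 := fun z => by
    simp [Q]
  have hQ0 : ∀ z, Conf z → MvPolynomial.eval z Q ≠ 0 := fun z hz => by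
    rw [hQ, Finset.prod_ne_zero_iff]
    exact fun q hq => pow_ne_zero _ (sub_ne_zero.2 (hz _ _ (Finset.mem_offDiag.1 hq).2.2))
  have hpoly : R.num * D = P * Q := by
    refine MvPolynomial.funext_set (fun i : Fin n => (fun t : ℝ => (t : ℂ)) ''
      Set.Ioo ((n : ℝ) - i) (n - i + 1)) (fun i => ?_) fun z hz => ?_
    · exact (Set.Ioo_infinite (by linarith)).image Complex.ofReal_injective.injOn
    · have hpos : OrderedPos z := by
        have hb : ∀ i : Fin n, (n : ℝ) - (i : ℕ) < ‖z i‖ ∧ ‖z i‖ < n - (i : ℕ) + 1 := fun i => by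
          obtain ⟨t, ht, he⟩ := hz i trivial
          have hi : ((i : ℕ) : ℝ) < n := by exact_mod_cast i.2
          rw [← he, Complex.norm_real, Real.norm_of_nonneg (by linarith [ht.1])]
          exact ht
        refine ⟨fun i j hij => ?_, fun i => ?_⟩
        · have : ((i : ℕ) : ℝ) + 1 ≤ (j : ℕ) := by exact_mod_cast hij
          linarith [(hb i).1, (hb j).2]
        · have hi : ((i : ℕ) : ℝ) < n := by exact_mod_cast i.2
          linarith [(hb i).1]
      have he := h z hpos
      rw [DiagRatFn.eval, ← hQ, div_eq_div_iff (hQ0 z hpos.conf) (hD z hpos.conf)] at he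
      rw [map_mul, map_mul, he]
  rw [DiagRatFn.eval, ← hQ, div_eq_div_iff (hQ0 z hz) (hD z hz), ← map_mul, ← map_mul, hpoly]

section Banded

variable {V : Type*} [AddCommGroup V] [Module ℂ V] {W : Type*} [AddCommGroup W] [Module ℂ W]

theorem CGrading.proj_proj (G : CGrading W) (m n : ℂ) (w : W) :
    G.proj m (G.proj n w) = if m = n then G.proj n w else 0 := by
  have h := LinearMap.congr_fun (G.proj_comp m n) w
  split_ifs at h ⊢ <;> simpa using h

theorem ZGrading.proj_proj (G : ZGrading V) (m n : ℤ) (v : V) :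
    G.proj m (G.proj n v) = if m = n then G.proj n v else 0 := by
  have h := LinearMap.congr_fun (G.proj_comp m n) v
  split_ifs at h ⊢ <;> simpa using h

theorem CGrading.sum_proj (G : CGrading W) (w : W) :
    ∑ n ∈ (G.proj_finite w).toFinset, G.proj n w = w :=
  (finsum_eq_sum _ (G.proj_finite w)).symm.trans (G.proj_sum w)

theorem ZGrading.sum_proj (G : ZGrading V) (v : V) :
    ∑ n ∈ (G.proj_finite v).toFinset, G.proj n v = v :=
  (finsum_eq_sum _ (G.proj_finite v)).symm.trans (G.proj_sum v)

theorem CGrading.d_proj (G : CGrading W) (n : ℂ) (w : W) :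
    G.d (G.proj n w) = n • G.proj n w := by
  rw [CGrading.d, finsum_eq_single _ n fun m hm => by rw [G.proj_proj, if_neg hm, smul_zero],
    G.proj_proj, if_pos rfl]

theorem ZGrading.d_proj (G : ZGrading V) (n : ℤ) (v : V) :
    G.d (G.proj n v) = (n : ℂ) • G.proj n v := by
  rw [ZGrading.d, finsum_eq_single _ n fun m hm => by rw [G.proj_proj, if_neg hm, smul_zero],
    G.proj_proj, if_pos rfl]

theorem CGrading.proj_d (G : CGrading W) (m : ℂ) (w : W) : G.proj m (G.d w) = m • G.proj m w := by
  have hd : G.d w = ∑ n ∈ (G.proj_finite w).toFinset, n • G.proj n w := by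
    refine finsum_eq_sum_of_support_subset _ fun n hn => ?_
    rw [Set.Finite.coe_toFinset]
    exact fun h => hn (by simp only [h, smul_zero])
  conv_rhs => rw [← G.sum_proj w, map_sum, Finset.smul_sum]
  rw [hd, map_sum]
  refine Finset.sum_congr rfl fun n _ => ?_
  rw [map_smul, G.proj_proj]
  split_ifs with h
  · rw [h]
  · simp

theorem CGrading.proj_eq_self_of_d (G : CGrading W) {c : ℂ} {w : W} (h : G.d w = c • w) :
    G.proj c w = w := by
  refine (finsum_eq_single (fun n => G.proj n w) c fun m hm => ?_).symm.trans (G.proj_sum w)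
  have h1 := G.proj_d m w
  rw [h, map_smul, ← sub_eq_zero, ← sub_smul] at h1
  exact (smul_eq_zero.1 h1).resolve_left (sub_ne_zero.2 hm.symm)

/-- The linear operators with finitely many homogeneous components. -/
def CGrading.Banded (G : CGrading W) (L : W →ₗ[ℂ] W) : Prop :=
  ∃ S : Finset ℂ, ∀ (m n : ℂ) (x : W), m - n ∉ S → G.proj m (L (G.proj n x)) = 0

theorem CGrading.banded_of_homogeneous (G : CGrading W) (H : ZGrading V)
    (T : V →ₗ[ℂ] W →ₗ[ℂ] W) (c : ℂ)
    (h : ∀ (a : ℤ) (n : ℂ) (u : V) (x : W),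
      G.proj (a + n + c) (T (H.proj a u) (G.proj n x)) = T (H.proj a u) (G.proj n x)) (u : V) :
    G.Banded (T u) := by
  classical
  refine ⟨(H.proj_finite u).toFinset.image fun a : ℤ => (a : ℂ) + c, fun m n x hmn => ?_⟩
  rw [← H.sum_proj u, map_sum, LinearMap.sum_apply, map_sum]
  refine Finset.sum_eq_zero fun a ha => ?_
  rw [← h, G.proj_proj, if_neg]
  rintro rfl
  exact hmn (Finset.mem_image.2 ⟨a, ha, by ring⟩)

theorem InGradedDual.finite_support {G : CGrading W} {φ : W →ₗ[ℂ] ℂ}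
    (hφ : InGradedDual G.proj φ) : (Function.support fun n => φ ∘ₗ G.proj n).Finite := hφ

theorem InGradedDual.eq_sum {G : CGrading W} {φ : W →ₗ[ℂ] ℂ} (hφ : InGradedDual G.proj φ) (x : W) :
    φ x = ∑ m ∈ hφ.finite_support.toFinset, φ (G.proj m x) := by
  have hfin : (Function.support fun m => φ (G.proj m x)).Finite :=
    (G.proj_finite x).subset fun m hm h => hm (by simp only [h, map_zero])
  conv_lhs => rw [← G.sum_proj x, map_sum]
  rw [← finsum_eq_sum_of_support_subset, ← finsum_eq_sum_of_support_subset]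
  · intro m hm
    rw [Set.Finite.coe_toFinset]
    exact fun h => hm (LinearMap.congr_fun h x)
  · intro m hm
    rw [Set.Finite.coe_toFinset]
    exact fun h => hm (by simp only [h, map_zero])

theorem InGradedDual.pair_eq_sum {G : CGrading W} {φ : W →ₗ[ℂ] ℂ} (hφ : InGradedDual G.proj φ)
    (y : G.Comp) : G.pair φ y = ∑ m ∈ hφ.finite_support.toFinset, φ (y.1 m) := by
  refine finsum_eq_sum_of_support_subset _ fun m hm => ?_
  rw [Set.Finite.coe_toFinset]
  refine fun h => hm ?_
  have h1 := LinearMap.congr_fun h (y.1 m)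
  rwa [LinearMap.comp_apply, y.2 m] at h1

theorem CGrading.Banded.exists_finset {G : CGrading W} {L : W →ₗ[ℂ] W} (hL : G.Banded L)
    (M : Finset ℂ) :
    ∃ T : Finset ℂ, ∀ m ∈ M, ∀ n ∉ T, ∀ x, G.proj m (L (G.proj n x)) = 0 := by
  classical
  obtain ⟨S, hS⟩ := hL
  refine ⟨Finset.image₂ (fun m s => m - s) M S, fun m hm n hn x => hS m n x fun h => hn ?_⟩
  exact Finset.mem_image₂.2 ⟨m, hm, m - n, h, by ring⟩

theorem CGrading.Banded.inGradedDual_comp {G : CGrading W} {L : W →ₗ[ℂ] W} (hL : G.Banded L)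
    {φ : W →ₗ[ℂ] ℂ} (hφ : InGradedDual G.proj φ) : InGradedDual G.proj (φ ∘ₗ L) := by
  obtain ⟨T, hT⟩ := hL.exists_finset hφ.finite_support.toFinset
  refine T.finite_toSet.subset fun n hn => ?_
  by_contra h
  refine hn (LinearMap.ext fun x => ?_)
  rw [LinearMap.comp_apply, LinearMap.comp_apply, hφ.eq_sum]
  exact Finset.sum_eq_zero fun m hm => by rw [hT m hm n h, map_zero]

theorem CGrading.Banded.pair_ext {G : CGrading W} {L : W →ₗ[ℂ] W} (hL : G.Banded L)
    {φ : W →ₗ[ℂ] ℂ} (hφ : InGradedDual G.proj φ) (y : G.Comp) :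
    G.pair φ (G.ext L y) = G.pair (φ ∘ₗ L) y := by
  obtain ⟨T, hT⟩ := hL.exists_finset hφ.finite_support.toFinset
  have hT' : ∀ m ∈ hφ.finite_support.toFinset, ∀ n ∉ T, G.proj m (L (y.1 n)) = 0 := fun m hm n hn => by
    rw [← y.2 n]
    exact hT m hm n hn _
  have hr : G.pair (φ ∘ₗ L) y = ∑ n ∈ T, φ (L (y.1 n)) := by
    refine finsum_eq_sum_of_support_subset _ fun n hn => ?_
    by_contra h
    refine hn ((hφ.eq_sum _).trans ?_)
    exact Finset.sum_eq_zero fun m hm => by rw [hT' m hm n h, map_zero]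
  rw [hφ.pair_eq_sum, hr, Finset.sum_congr rfl fun n _ => hφ.eq_sum (L (y.1 n)), Finset.sum_comm]
  refine Finset.sum_congr rfl fun m hm => ?_
  rw [← map_sum]
  refine congrArg φ (finsum_eq_sum_of_support_subset _ fun n hn => ?_)
  by_contra h
  exact hn (hT' m hm n h)

/-- Pairing with a product of banded operators amounts to pairing with a functional. -/
theorem CGrading.exists_functional_compApply (G : CGrading W) (m : ℕ) (L : Fin m → W →ₗ[ℂ] W)
    (hL : ∀ i, G.Banded (L i)) (φ : W →ₗ[ℂ] ℂ) (hφ : InGradedDual G.proj φ) :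
    ∃ ψ : W →ₗ[ℂ] ℂ, InGradedDual G.proj ψ ∧
      (∀ x, φ (compApply m (fun i => ⇑(L i)) x) = ψ x) ∧
      ∀ y, G.pair φ (compApply m (fun i => G.ext (L i)) y) = G.pair ψ y := by
  induction m generalizing φ with
  | zero => exact ⟨φ, hφ, fun _ => rfl, fun _ => rfl⟩
  | succ m ih =>
    obtain ⟨ψ, h1, h2, h3⟩ := ih (fun i => L i.succ) (fun i => hL i.succ) (φ ∘ₗ L 0)
      ((hL 0).inGradedDual_comp hφ)
    exact ⟨ψ, h1, h2, fun y => ((hL 0).pair_ext hφ _).trans (h3 y)⟩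

end Banded

section Bimod

variable {V : Type*} [AddCommGroup V] [Module ℂ V] {W : Type*} [AddCommGroup W] [Module ℂ W]
  {A : MOSVA V} (B : Bimod A W)

/-- A coefficient of the left vertex operator map, as a bilinear map. -/
def Bimod.leftCoeff (k : ℤ) : V →ₗ[ℂ] W →ₗ[ℂ] W :=
  LinearMap.mk₂ ℂ (fun u w => B.YL u w k) (by simp) (by simp) (by simp) (by simp)

theorem Bimod.finite_support_YsR (u : V) (w : W) (k : ℤ) :
    (Function.support fun j : ℕ => (((-1 : ℂ) ^ (k + (j : ℤ) + 1)) * ((j.factorial : ℂ))⁻¹) •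
      ((B.DW ^ j) (B.YR w u (k + (j : ℤ))))).Finite := by
  obtain ⟨N, hN⟩ := B.truncR w u
  refine (Set.finite_Iio (N - k).toNat).subset fun j hj => ?_
  by_contra h
  refine hj ?_
  simp only [Set.mem_Iio, not_lt] at h
  simp only [hN (k + j) (by omega), map_zero, smul_zero]

/-- A coefficient of the opposite right vertex operator map, as a bilinear map. -/
def Bimod.rightCoeff (k : ℤ) : V →ₗ[ℂ] W →ₗ[ℂ] W :=
  LinearMap.mk₂ ℂ (fun u w => B.YsR u w k)
    (fun u u' w => by
      simp only [Bimod.YsR]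
      rw [← finsum_add_distrib (B.finite_support_YsR u w k) (B.finite_support_YsR u' w k)]
      simp only [map_add, Pi.add_apply, smul_add])
    (fun c u w => by
      simp only [Bimod.YsR]
      rw [smul_finsum' _ (B.finite_support_YsR u w k)]
      simp only [map_smul, Pi.smul_apply, smul_comm c])
    (fun u w w' => by
      simp only [Bimod.YsR]
      rw [← finsum_add_distrib (B.finite_support_YsR u w k) (B.finite_support_YsR u w' k)]
      simp only [map_add, LinearMap.add_apply, Pi.add_apply, smul_add])
    (fun c u w => by
      simp only [Bimod.YsR]
      rw [smul_finsum' _ (B.finite_support_YsR u w k)]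
      simp only [map_smul, LinearMap.smul_apply, Pi.smul_apply, smul_comm c])

theorem Bimod.proj_YL (a : ℤ) (n : ℂ) (u : V) (x : W) (k : ℤ) :
    B.gr.proj (a + n + (-k - 1)) (B.YL (A.gr.proj a u) (B.gr.proj n x) k) =
      B.YL (A.gr.proj a u) (B.gr.proj n x) k := by
  refine B.gr.proj_eq_self_of_d ?_
  rw [B.d_commL, A.gr.d_proj, B.gr.d_proj]
  simp only [map_smul, LinearMap.smul_apply, Pi.smul_apply]
  module

theorem Bimod.proj_YR (a : ℤ) (n : ℂ) (u : V) (x : W) (k : ℤ) :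
    B.gr.proj (a + n + (-k - 1)) (B.YR (B.gr.proj n x) (A.gr.proj a u) k) =
      B.YR (B.gr.proj n x) (A.gr.proj a u) k := by
  refine B.gr.proj_eq_self_of_d ?_
  rw [B.d_commR, A.gr.d_proj, B.gr.d_proj]
  simp only [map_smul, LinearMap.smul_apply, Pi.smul_apply]
  module

theorem Bimod.proj_DW_pow {c : ℂ} {x : W} (hx : B.gr.proj c x = x) (j : ℕ) :
    B.gr.proj (c + j) ((B.DW ^ j) x) = (B.DW ^ j) x := by
  induction j with
  | zero => simpa using hx
  | succ j ih =>
    have h := LinearMap.congr_fun (B.DW_wt (c + j)) ((B.DW ^ j) x)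
    simp only [LinearMap.comp_apply, ih] at h
    rw [pow_succ', Module.End.mul_apply, Nat.cast_succ, ← add_assoc]
    exact h.symm

theorem Bimod.proj_YsR (a : ℤ) (n : ℂ) (u : V) (x : W) (k : ℤ) :
    B.gr.proj (a + n + (-k - 1)) (B.YsR (A.gr.proj a u) (B.gr.proj n x) k) =
      B.YsR (A.gr.proj a u) (B.gr.proj n x) k := by
  rw [Bimod.YsR, finsum_eq_sum _ (B.finite_support_YsR _ _ k), map_sum]
  refine Finset.sum_congr rfl fun j _ => ?_
  rw [map_smul]
  congr 1
  have h := B.proj_DW_pow (B.proj_YR a n u x (k + j)) j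
  convert h using 3
  push_cast
  ring

/-- A coefficient of a left or opposite right vertex operator, as a linear operator. -/
def Bimod.coeffOp (s : Bool) (u : V) (k : ℤ) : W →ₗ[ℂ] W :=
  if s then B.leftCoeff k u else B.rightCoeff k u

theorem Bimod.banded_coeffOp (s : Bool) (u : V) (k : ℤ) : B.gr.Banded (B.coeffOp s u k) := by
  cases s
  · exact B.gr.banded_of_homogeneous A.gr (B.rightCoeff k) (-k - 1)
      (fun a n u x => B.proj_YsR a n u x k) u
  · exact B.gr.banded_of_homogeneous A.gr (B.leftCoeff k) (-k - 1)
      (fun a n u x => B.proj_YL a n u x k) u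

theorem patOps_eq_coeffOp {n : ℕ} (s : Fin n → Bool) (u : Fin n → V) (k : Fin n → ℤ) (i : Fin n) :
    patOps B s u k i = B.coeffOp (s i) (u i) (k i) := by
  rw [patOps, Bimod.coeffOp]
  cases s i <;> rfl

theorem patOps_append {m n : ℕ} (s : Fin m → Bool) (t : Fin n → Bool) (v : Fin m → V)
    (u : Fin n → V) (K : Fin m → ℤ) (k : Fin n → ℤ) :
    patOps B (Fin.append s t) (Fin.append v u) (Fin.append K k) =
      Fin.append (patOps B s v K) (patOps B t u k) := by
  funext i
  induction i using Fin.addCases <;> simp [patOps]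

end Bimod

/-- With `V`, `W`, `u`, `l`, `w` as in Statement 4, let `m ≥ 1`,
`v₁,…,v_m ∈ V` and `0 ≤ p ≤ m`. If `g` represents
`E(Y_W^L(u₁,z_{m+1})⋯Y_W^{s(R)}(uₙ,z_{m+n})w)` and `f` represents the full product
`E(Y_W^L(v₁,z₁)⋯Y_W^L(v_p,z_p)Y_W^{s(R)}(v_{p+1},z_{p+1})⋯Y_W^{s(R)}(v_m,z_m)·
Y_W^L(u₁,z_{m+1})⋯Y_W^{s(R)}(uₙ,z_{m+n})w)`, then the series
`Y_W^L(v₁,z₁)⋯Y_W^{s(R)}(v_m,z_m)·g(z_{m+1},…,z_{m+n})` converges absolutely when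
`|z₁| > ⋯ > |z_m| > |z_i|` (`i = m+1,…,m+n`) to the corresponding value of `f`. -/
theorem statement5 {V : Type*} [AddCommGroup V] [Module ℂ V]
    {W : Type*} [AddCommGroup W] [Module ℂ W]
    (A : MOSVA V) (B : Bimod A W) (hA : A.PoleOrder) (hB : B.PoleOrder)
    (n : ℕ) (l : ℕ) (hl : l ≤ n)
    (u : Fin n → V) (w : W) (hw : B.RegVec w)
    (m : ℕ) (hm : 0 < m) (p : ℕ) (hp : p ≤ m) (v : Fin m → V)
    (g : (Fin n → ℂ) → B.gr.Comp) (hg : RepEPat B (prefixPat n l) u w g)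
    (f : (Fin (m+n) → ℂ) → B.gr.Comp)
    (hf : RepEPat B (Fin.append (prefixPat m p) (prefixPat n l)) (Fin.append v u) w f) :
    ∀ (zo : Fin m → ℂ) (zt : Fin n → ℂ), Conf (Fin.append zo zt) →
      Ordered zo → (∀ (i : Fin m) (j : Fin n), ‖zt j‖ < ‖zo i‖) →
      ∀ φ : W →ₗ[ℂ] ℂ, InGradedDual B.gr.proj φ →
        AbsConvTo (fun K : Fin m → ℤ =>
            B.gr.pair φ (compApply m
                (fun i => B.gr.ext (patOps B (prefixPat m p) v K i)) (g zt))
              * ∏ i, zo i ^ (-(K i) - 1))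
          (B.gr.pair φ (f (Fin.append zo zt))) := by
  intro zo zt hconf ho hot φ hφ
  choose ψ hψ hψW hψC using fun K : Fin m → ℤ =>
    B.gr.exists_functional_compApply m (fun i => B.coeffOp (prefixPat m p i) (v i) (K i))
      (fun i => B.banded_coeffOp _ _ _) φ hφ
  simp only [← patOps_eq_coeffOp] at hψW hψC
  obtain ⟨R, hR⟩ := hf.1.1 φ hφ
  obtain ⟨P, D, hD, hexp⟩ := R.exists_expansion
  choose Q hQ using fun K => hg.1.1 (ψ K) (hψ K)
  have hpos : ∀ zt, OrderedPos zt → ∀ K,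
      (Q K).eval zt = MvPolynomial.eval zt (P K) / MvPolynomial.eval zt D := fun zt hzt => by
    obtain ⟨r, hr, hrad⟩ := exists_dominating_radii m zt
    refine congrFun (laurent_residueExponents_unique r hr (F := fun zo => R.eval (Fin.append zo zt))
      (fun zo hzo => ?_) fun zo hzo => ?_)
    · obtain ⟨ho, hot⟩ := hrad zo hzo
      have hord := orderedPos_append ho hzt hot
      have h := (Fin.appendEquiv m n).hasSum_iff.2 (hf.2 φ hφ _ hord).2
      rw [hR _ hord.conf] at h
      refine h.prod_fiberwise fun K => ?_
      rw [← hQ K zt hzt.conf]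
      refine (congrArg (HasSum · _) (funext fun k => ?_)).mpr
        ((hg.2 (ψ K) (hψ K) zt hzt).2.mul_right (∏ i, zo i ^ (-(K i) - 1)))
      rw [Function.comp_apply, show Fin.appendEquiv m n (K, k) = Fin.append K k from rfl,
        patOps_append, compApply_append, hψW, Fin.prod_univ_add]
      simp only [Fin.append_left, Fin.append_right]
      ring
    · obtain ⟨ho, hot⟩ := hrad zo hzo
      exact hexp zo zt hzt.conf (append_mem_dominatedRegion ho.1 hot)
  have hzt : Conf zt := fun i j hij h => hconf (Fin.natAdd m i) (Fin.natAdd m j)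
    (fun h => hij (Fin.natAdd_injective n m h)) (by simpa using h)
  rw [absConvTo_iff, hR _ hconf]
  refine (congrArg (HasSum · _) (funext fun K => ?_)).mpr
    (hexp zo zt hzt (append_mem_dominatedRegion ho hot))
  rw [hψC, hQ K zt hzt, (Q K).eval_eq_of_orderedPos hD (fun z hz => hpos z hz K) hzt]

end VA
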